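/- Let 𝒜 be an abelian category with enough projective objects and let M be an object of 𝒜 with qpd_𝒜(M) < ∞ such that Ext_𝒜^n(M, M) = 0 for all integers n ≥ 2. Then pd_𝒜(M) < ∞. -/

import Mathlib

/-!
Quasi-projective dimension, following Gheibi–Jorgensen–Takahashi and
Chen–Chen–Liu, "Properties of quasi-projective dimension over abelian categories".
-/

open CategoryTheory CategoryTheory.Limits

attribute [local instance] CategoryTheory.Abelian.hasFiniteBiproducts

noncomputable section

universe v u

namespace QPD

variable {A : Type*} [Category A] [Abelian A]

/-- The direct sum of `n` copies of `M`. -/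
def copies (M : A) (n : ℕ) : A := ⨁ (fun _ : Fin n => M)

/-- `X` belongs to `add M`: it is a direct summand of a finite direct sum of copies of `M`. -/
def inAdd (M X : A) : Prop :=
  ∃ (n : ℕ) (s : X ⟶ copies M n) (r : copies M n ⟶ X), s ≫ r = 𝟙 X

/-- `P` is a quasi-projective resolution of `M`: a bounded-below complex of projective
objects whose `j`-th homology is a direct sum of `mult j` copies of `M`, where the
multiplicities `mult j` are not all zero. -/
structure IsQuasiProjRes (M : A) (P : ChainComplex A ℤ) : Prop where
  projective : ∀ i, Projective (P.X i)
  bddBelow : ∃ a : ℤ, ∀ i, i < a → IsZero (P.X i)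
  homology_iso : ∃ mult : ℤ → ℕ, (∃ j, mult j ≠ 0) ∧
    ∀ j, Nonempty (P.homology j ≅ copies M (mult j))

/-- `P` is a finite (i.e. bounded) quasi-projective resolution of `M`. -/
structure IsFiniteQuasiProjRes (M : A) (P : ChainComplex A ℤ) extends
    IsQuasiProjRes M P : Prop where
  bddAbove : ∃ b : ℤ, ∀ i, b < i → IsZero (P.X i)

/-- `s` is the supremum of the degrees in which `P` is nonzero. -/
def IsSup (P : ChainComplex A ℤ) (s : ℤ) : Prop :=
  ¬ IsZero (P.X s) ∧ ∀ i, s < i → IsZero (P.X i)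

/-- `t` is the supremum of the degrees in which the homology of `P` is nonzero. -/
def IsHSup (P : ChainComplex A ℤ) (t : ℤ) : Prop :=
  ¬ IsZero (P.homology t) ∧ ∀ i, t < i → IsZero (P.homology i)

/-- `t` is the infimum of the degrees in which the homology of `P` is nonzero. -/
def IsHInf (P : ChainComplex A ℤ) (t : ℤ) : Prop :=
  ¬ IsZero (P.homology t) ∧ ∀ i, i < t → IsZero (P.homology i)

open Classical in
/-- The quasi-projective dimension of `M`, as an element of `ℕ∞`: the infimum of
`sup P• - hsup P•` over all finite quasi-projective resolutions `P•` of `M`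
(it is `0` for the zero object and `⊤` if no finite quasi-projective resolution exists). -/
def qpd (M : A) : ℕ∞ :=
  if IsZero M then 0
  else sInf {d : ℕ∞ | ∃ (P : ChainComplex A ℤ) (s t : ℤ),
    IsFiniteQuasiProjRes M P ∧ IsSup P s ∧ IsHSup P t ∧ d = ((s - t).toNat : ℕ∞)}

/-- `M` admits a projective resolution of length at most `n`. -/
def pdLE (M : A) (n : ℕ) : Prop :=
  ∃ P : ChainComplex A ℤ, (∀ i, Projective (P.X i)) ∧
    (∀ i : ℤ, i < 0 → IsZero (P.X i)) ∧ (∀ i : ℤ, (n : ℤ) < i → IsZero (P.X i)) ∧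
    (∀ i : ℤ, i ≠ 0 → IsZero (P.homology i)) ∧ Nonempty (P.homology 0 ≅ M)

/-- The projective dimension of `M`, as an element of `ℕ∞`. -/
def pd (M : A) : ℕ∞ := sInf {d : ℕ∞ | ∃ n : ℕ, d = (n : ℕ∞) ∧ pdLE M n}

open Classical in
/-- Quasi-projective dimension computed using only complexes all of whose terms satisfy the
predicate `Q` (e.g. `Q` = "finitely generated", for the category of finitely presented
modules over a left coherent ring). -/
def qpdRel (Q : A → Prop) (M : A) : ℕ∞ :=
  if IsZero M then 0
  else sInf {d : ℕ∞ | ∃ (P : ChainComplex A ℤ) (s t : ℤ),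
    IsFiniteQuasiProjRes M P ∧ (∀ i, Q (P.X i)) ∧ IsSup P s ∧ IsHSup P t ∧
    d = ((s - t).toNat : ℕ∞)}

/-- Projective dimension computed using only resolutions all of whose terms satisfy the
predicate `Q`. -/
def pdRel (Q : A → Prop) (M : A) : ℕ∞ :=
  sInf {d : ℕ∞ | ∃ n : ℕ, d = (n : ℕ∞) ∧ ∃ P : ChainComplex A ℤ,
    (∀ i, Projective (P.X i)) ∧ (∀ i, Q (P.X i)) ∧
    (∀ i : ℤ, i < 0 → IsZero (P.X i)) ∧ (∀ i : ℤ, (n : ℤ) < i → IsZero (P.X i)) ∧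
    (∀ i : ℤ, i ≠ 0 → IsZero (P.homology i)) ∧ Nonempty (P.homology 0 ≅ M)}

/-- Vanishing of the `n`-th Ext group, `Ext_𝒜^n(M, N) = 0`. -/
def extIsZero [EnoughProjectives A] (M N : A) (n : ℕ) : Prop :=
  IsZero (((_root_.Ext ℤ A n).obj (Opposite.op M)).obj N)

/-- The quasi-projective dimension of a finitely presented module over a (left coherent)
ring, computed inside the abelian category of finitely presented modules, i.e. via bounded
complexes of finitely generated projective modules. -/
def qpdFG {R : Type u} [Ring R] (M : ModuleCat.{u} R) : ℕ∞ :=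
  qpdRel (fun N : ModuleCat.{u} R => Module.Finite R N) M

/-- The projective dimension of a finitely presented module over a (left coherent) ring,
computed inside the abelian category of finitely presented modules. -/
def pdFG {R : Type u} [Ring R] (M : ModuleCat.{u} R) : ℕ∞ :=
  pdRel (fun N : ModuleCat.{u} R => Module.Finite R N) M

/-- A ring is left coherent if every finitely generated left ideal is finitely presented. -/
def IsLeftCoherent (R : Type u) [Ring R] : Prop :=
  ∀ I : Ideal R, I.FG → Module.FinitePresentation R I

/-- The quasi-global dimension of a ring: the supremum of the quasi-projective dimensions
of all finitely generated left modules. -/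
def qgldim (R : Type u) [Ring R] : ℕ∞ :=
  sSup {d : ℕ∞ | ∃ M : ModuleCat.{u} R, Module.Finite R M ∧ d = qpd M}

/-- The global dimension of a ring: the supremum of the projective dimensions of all
finitely generated left modules. -/
def gldim (R : Type u) [Ring R] : ℕ∞ :=
  sSup {d : ℕ∞ | ∃ M : ModuleCat.{u} R, Module.Finite R M ∧ d = pd M}

/-- The finitistic dimension of a ring: the supremum of the projective dimensions of all
finitely generated left modules of finite projective dimension. -/
def findim (R : Type u) [Ring R] : ℕ∞ :=
  sSup {d : ℕ∞ | ∃ M : ModuleCat.{u} R, Module.Finite R M ∧ d = pd M ∧ pd M ≠ ⊤}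

/-- The depth of a module over a Noetherian local ring:
`depth M = inf {i : Ext^i(R/𝔪, M) ≠ 0}`. -/
def depth {R : Type u} [CommRing R] [IsLocalRing R] (M : ModuleCat.{u} R) : ℕ∞ :=
  sInf {d : ℕ∞ | ∃ n : ℕ, d = (n : ℕ∞) ∧
    ¬ IsZero (((_root_.Ext ℤ (ModuleCat.{u} R) n).obj
      (Opposite.op (ModuleCat.of R (IsLocalRing.ResidueField R)))).obj M)}

end QPD

end

noncomputable section

open QPD

variable {A : Type*} [Category A] [Abelian A]

namespace QPD

/-- If `Ext^(n+1)(M, N) = 0`, then every `(n+1)`-cocycle of `Hom(Q, N)` is a coboundary, for any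
projective resolution `Q` of `M`. -/
lemma extIsZero.exists_d_comp_eq [EnoughProjectives A] {M N : A} {n : ℕ}
    (h : extIsZero M N (n + 1)) (Q : ProjectiveResolution M)
    (φ : Q.complex.X (n + 1) ⟶ N) (hφ : Q.complex.d (n + 2) (n + 1) ≫ φ = 0) :
    ∃ ψ : Q.complex.X n ⟶ N, Q.complex.d (n + 1) n ≫ ψ = φ := by
  have hz : IsZero ((Q.complex.linearYonedaObj ℤ N).homology (n + 1)) :=
    IsZero.of_iso h (Q.isoExt (n + 1) N).symm
  rw [← HomologicalComplex.exactAt_iff_isZero_homology,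
    HomologicalComplex.exactAt_iff' _ n (n + 1) (n + 2) (by simp) (by simp),
    ShortComplex.moduleCat_exact_iff] at hz
  obtain ⟨ψ, hψ⟩ := hz φ hφ
  exact ⟨ψ, hψ⟩

lemma extIsZero.exists_d_comp_eq_copies [EnoughProjectives A] {M N : A} {n : ℕ}
    (h : extIsZero M N (n + 1)) (Q : ProjectiveResolution M) {m : ℕ}
    (φ : Q.complex.X (n + 1) ⟶ copies N m) (hφ : Q.complex.d (n + 2) (n + 1) ≫ φ = 0) :
    ∃ ψ : Q.complex.X n ⟶ copies N m, Q.complex.d (n + 1) n ≫ ψ = φ := by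
  unfold copies at *
  choose ψ hψ using fun i : Fin m => h.exists_d_comp_eq Q (φ ≫ biproduct.π (fun _ : Fin m => N) i)
    (by rw [reassoc_of% hφ, zero_comp])
  exact ⟨biproduct.lift ψ, biproduct.hom_ext _ _ fun i => by
    rw [Category.assoc, biproduct.lift_π, hψ]⟩

lemma exists_retract_copies (M : A) {m : ℕ} (hm : m ≠ 0) :
    ∃ (s : M ⟶ copies M m) (r : copies M m ⟶ M), s ≫ r = 𝟙 M :=
  ⟨biproduct.ι (fun _ : Fin m => M) ⟨0, Nat.pos_of_ne_zero hm⟩, biproduct.π _ _,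
    biproduct.ι_π_self _ _⟩

lemma isZero_copies_zero (M : A) : IsZero (copies M 0) :=
  (IsZero.iff_id_eq_zero _).2 (biproduct.hom_ext (f := fun _ : Fin 0 => M) _ _ fun i => i.elim0)

lemma not_isZero_copies {M : A} (hM : ¬ IsZero M) {m : ℕ} (hm : m ≠ 0) :
    ¬ IsZero (copies M m) := fun h => hM <| by
  obtain ⟨s, r, hsr⟩ := exists_retract_copies M hm
  rw [IsZero.iff_id_eq_zero, ← hsr, h.eq_of_tgt s 0, zero_comp]

end QPD

/-- `X` is a retract of `W` up to a morphism factoring through a projective object. -/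
def IsStableRetract (X W : A) : Prop :=
  ∃ (T : A) (_ : Projective T) (f : X ⟶ W) (g : W ⟶ X) (a : X ⟶ T) (b : T ⟶ X),
    f ≫ g = 𝟙 X + a ≫ b

lemma IsStableRetract.projective_of_isZero {X W : A} (h : IsStableRetract X W) (hW : IsZero W) :
    Projective X := by
  obtain ⟨T, _, f, g, a, b, h⟩ := h
  rw [hW.eq_of_tgt f 0, zero_comp] at h
  refine Retract.projective (X := X) (Y := T) ⟨-a, b, ?_⟩
  rw [Preadditive.neg_comp, neg_eq_iff_add_eq_zero, add_comm, h]

/-- Passing to syzygies of stable retracts: `X'` is a syzygy of `X`, and `W'` maps to the syzygy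
of `W` in such a way that morphisms from `X'` to it lift. -/
lemma IsStableRetract.syzygy {X W X' W' Q P : A} (h : IsStableRetract X W)
    [Projective Q] [Projective P] (i : X' ⟶ Q) (q : Q ⟶ X) (w : i ≫ q = 0) [Mono i] [Epi q]
    (hX : (ShortComplex.mk i q w).Exact)
    (j : W' ⟶ P) (p : P ⟶ W) (w' : j ≫ p = 0) [Epi p]
    (lift : ∀ u : X' ⟶ P, u ≫ p = 0 → ∃ v : X' ⟶ W', v ≫ j = u) :
    IsStableRetract X' W' := by
  obtain ⟨T, _, f, g, a, b, h⟩ := h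
  let F := Projective.factorThru (q ≫ f) p
  let G := Projective.factorThru (p ≫ g) q
  have hF : F ≫ p = q ≫ f := Projective.factorThru_comp _ _
  have hG : G ≫ q = p ≫ g := Projective.factorThru_comp _ _
  let b' := Projective.factorThru b q
  have hb : b' ≫ q = b := Projective.factorThru_comp _ _
  obtain ⟨f', hf'⟩ := lift (i ≫ F) (by rw [Category.assoc, hF, reassoc_of% w, zero_comp])
  have hg := hX.lift' (j ≫ G) (by dsimp; rw [Category.assoc, hG, reassoc_of% w', zero_comp])
  obtain ⟨g', hg'⟩ := hg
  obtain ⟨c, hc⟩ := hX.lift' (F ≫ G - 𝟙 Q - q ≫ a ≫ b') (by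
    dsimp
    simp only [Preadditive.sub_comp, Category.assoc, hG, reassoc_of% hF, h, hb,
      Preadditive.comp_add, Category.comp_id, Category.id_comp]
    abel)
  dsimp at hg' hc
  refine ⟨Q, inferInstance, f', g', i, c, ?_⟩
  rw [← cancel_mono i]
  simp only [Category.assoc, hg', reassoc_of% hf', Preadditive.add_comp, hc, Preadditive.comp_sub,
    reassoc_of% w, Category.comp_id, Category.id_comp, zero_comp]
  abel

namespace HomologicalComplex

variable {ι : Type*} {c : ComplexShape ι} (K : HomologicalComplex A c)

lemma exact_homologyι_fromOpcycles (i j : ι) (hij : c.next i = j) :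
    (ShortComplex.mk _ _ (K.homologyι_comp_fromOpcycles i j)).Exact :=
  ShortComplex.exact_of_f_is_kernel _ (K.homologyIsKernel i j hij)

lemma fromOpcycles_pOpcycles (i j : ι) : K.fromOpcycles i j ≫ K.pOpcycles j = 0 := by
  rw [← cancel_epi (K.pOpcycles i), p_fromOpcycles_assoc, d_pOpcycles, comp_zero]

lemma exact_d_pOpcycles (i j : ι) (hij : c.prev j = i) :
    (ShortComplex.mk _ _ (K.d_pOpcycles i j)).Exact :=
  ShortComplex.exact_of_g_is_cokernel _ (K.opcyclesIsCokernel i j hij)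

lemma exact_fromOpcycles_pOpcycles (i j : ι) (hij : c.prev j = i) :
    (ShortComplex.mk _ _ (K.fromOpcycles_pOpcycles i j)).Exact := by
  let φ : ShortComplex.mk _ _ (K.d_pOpcycles i j) ⟶
      ShortComplex.mk _ _ (K.fromOpcycles_pOpcycles i j) :=
    { τ₁ := K.pOpcycles i
      τ₂ := 𝟙 _
      τ₃ := 𝟙 _ }
  have : Epi φ.τ₁ := by dsimp [φ]; infer_instance
  have : IsIso φ.τ₂ := by dsimp [φ]; infer_instance
  have : Mono φ.τ₃ := by dsimp [φ]; infer_instance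
  exact (ShortComplex.exact_iff_of_epi_of_isIso_of_mono φ).1 (K.exact_d_pOpcycles i j hij)

/-- If `K.X j` and `K.opcycles j` are projective, then `K.opcycles i` is the direct sum of
`K.homology i` and of a projective object. -/
lemma exists_retraction_homologyι (i j : ι) (hij : c.Rel i j) (hj : Projective (K.X j))
    (hj' : Projective (K.opcycles j)) :
    ∃ r : K.opcycles i ⟶ K.homology i, K.homologyι i ≫ r = 𝟙 _ ∧
      ∃ (T : A) (_ : Projective T) (a : K.opcycles i ⟶ T) (b : T ⟶ K.opcycles i),
        a ≫ b = 𝟙 _ - r ≫ K.homologyι i := by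
  have hS := K.exact_fromOpcycles_pOpcycles i j (c.prev_eq' hij)
  let s := Projective.factorThru (𝟙 _) (K.pOpcycles j)
  have hs : s ≫ K.pOpcycles j = 𝟙 _ := Projective.factorThru_comp _ _
  let z := kernel.ι (K.pOpcycles j)
  obtain ⟨ρ, hρ⟩ : ∃ ρ : K.X j ⟶ kernel (K.pOpcycles j), ρ ≫ z = 𝟙 _ - K.pOpcycles j ≫ s :=
    ⟨kernel.lift _ (𝟙 _ - K.pOpcycles j ≫ s) (by simp [hs]), by simp [z]⟩
  have hT : Projective (kernel (K.pOpcycles j)) := Retract.projective (Y := K.X j) ⟨z, ρ, by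
    rw [← cancel_mono z]; simp [hρ, z]⟩
  obtain ⟨b, hb⟩ : ∃ b : kernel (K.pOpcycles j) ⟶ K.opcycles i, b ≫ K.fromOpcycles i j = z :=
    ⟨hS.liftFromProjective z (by simp [z]), hS.liftFromProjective_comp _ _⟩
  let a := kernel.lift _ _ (K.fromOpcycles_pOpcycles i j)
  have ha : a ≫ z = K.fromOpcycles i j := kernel.lift_ι _ _ _
  obtain ⟨r, hr⟩ := (K.exact_homologyι_fromOpcycles i j (c.next_eq' hij)).lift' (𝟙 _ - a ≫ b) (by
    simp [hb, ha])
  dsimp at hr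
  refine ⟨r, ?_, _, hT, a, b, by rw [hr]; abel⟩
  have : K.homologyι i ≫ a = 0 := by rw [← cancel_mono z]; simp [ha]
  rw [← cancel_mono (K.homologyι i)]
  simp [hr, reassoc_of% this]

lemma projective_opcycles_of_isZero_homology (i j : ι) (hij : c.Rel i j)
    (hj : Projective (K.X j)) (hj' : Projective (K.opcycles j)) (hi : IsZero (K.homology i)) :
    Projective (K.opcycles i) := by
  obtain ⟨r, -, T, _, a, b, h⟩ := K.exists_retraction_homologyι i j hij hj hj'
  refine Retract.projective (Y := T) ⟨a, b, ?_⟩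
  rw [h, hi.eq_of_tgt r 0, zero_comp, sub_zero]

end HomologicalComplex

lemma IsStableRetract.of_iso {X Y W : A} (h : IsStableRetract X W) (e : X ≅ Y) :
    IsStableRetract Y W := by
  obtain ⟨T, hT, f, g, a, b, h⟩ := h
  exact ⟨T, hT, e.inv ≫ f, g ≫ e.hom, e.inv ≫ a, b ≫ e.hom, by simp [reassoc_of% h]⟩

namespace CategoryTheory.ProjectiveResolution

variable {M : A} (Q : ProjectiveResolution M)

/-- The opcycles in degree `0` of a projective resolution of `M` identify to `M`. -/
def opcyclesZeroIso : Q.complex.opcycles 0 ≅ M :=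
  (Q.complex.opcyclesIsCokernel 1 0 (by simp)).coconePointUniqueUpToIso Q.isColimitCokernelCofork

lemma mono_fromOpcycles (n : ℕ) : Mono (Q.complex.fromOpcycles (n + 1) n) :=
  (Q.complex.exact_homologyι_fromOpcycles (n + 1) n (by simp)).mono_g
    ((Q.complex_exactAt_succ n).isZero_homology.eq_of_src _ _)

end CategoryTheory.ProjectiveResolution

namespace QPD

/-- If `M` has no self-extensions in degrees `≥ 2` and is a stable retract of the opcycles in
degree `t` of a complex `P` of projective objects whose homology consists of direct sums of copies
of `M`, then the syzygies of `M` are stable retracts of the opcycles of `P`. -/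
lemma isStableRetract_opcycles [EnoughProjectives A] {M : A} (Q : ProjectiveResolution M)
    (h2 : ∀ n : ℕ, 2 ≤ n → extIsZero M M n) (P : ChainComplex A ℤ)
    (hP : ∀ i, Projective (P.X i)) (mult : ℤ → ℕ)
    (e : ∀ j, Nonempty (P.homology j ≅ copies M (mult j))) {t : ℤ}
    (h : IsStableRetract M (P.opcycles t)) (n : ℕ) :
    IsStableRetract (Q.complex.opcycles n) (P.opcycles (t + n)) := by
  induction n with
  | zero =>
    rw [Nat.cast_zero, add_zero]
    exact h.of_iso Q.opcyclesZeroIso.symm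
  | succ n ih =>
    have := Q.mono_fromOpcycles n
    rw [Nat.cast_succ, ← add_assoc]
    generalize t + n = s at *
    refine ih.syzygy (Q.complex.fromOpcycles (n + 1) n) (Q.complex.pOpcycles n)
      (Q.complex.fromOpcycles_pOpcycles _ _)
      (Q.complex.exact_fromOpcycles_pOpcycles _ _ (by simp))
      (P.fromOpcycles (s + 1) s) (P.pOpcycles s) (P.fromOpcycles_pOpcycles _ _) fun u hu => ?_
    have hex := P.exact_fromOpcycles_pOpcycles (s + 1) s (by simp)
    let v := hex.liftFromProjective (Q.complex.pOpcycles (n + 1) ≫ u) (by simp [hu])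
    have hv : v ≫ P.fromOpcycles (s + 1) s = Q.complex.pOpcycles (n + 1) ≫ u :=
      hex.liftFromProjective_comp _ _
    obtain ⟨φ, hφ⟩ := (P.exact_homologyι_fromOpcycles (s + 1) s (by simp)).lift'
      (Q.complex.d (n + 2) (n + 1) ≫ v) (by simp [hv])
    dsimp at hφ
    obtain ⟨e⟩ := e (s + 1)
    have hφ' : Q.complex.d (n + 3) (n + 2) ≫ φ = 0 := by
      rw [← cancel_mono (P.homologyι (s + 1))]
      simp [hφ]
    obtain ⟨ψ, hψ⟩ := (h2 (n + 2) (by lia)).exists_d_comp_eq_copies Q (φ ≫ e.hom)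
      (by rw [reassoc_of% hφ', zero_comp])
    refine ⟨Q.complex.descOpcycles (v - ψ ≫ e.inv ≫ P.homologyι (s + 1)) (n + 2) (by simp) ?_, ?_⟩
    · simp [reassoc_of% hψ, hφ]
    · rw [← cancel_epi (Q.complex.pOpcycles (n + 1))]
      simp [hv]

/-- If a complex of projective objects is bounded below, and its homology vanishes below degree `t`,
then `P.homology t` is a direct summand of `P.opcycles t`. -/
lemma exists_retraction_homologyι_of_isZero (P : ChainComplex A ℤ)
    (hP : ∀ i, Projective (P.X i)) {a : ℤ} (ha : ∀ i, i < a → IsZero (P.X i)) {t : ℤ}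
    (ht : ∀ i, i < t → IsZero (P.homology i)) :
    ∃ r : P.opcycles t ⟶ P.homology t, P.homologyι t ≫ r = 𝟙 _ := by
  have hlow (i : ℤ) (hi : i < a) : Projective (P.opcycles i) := by
    have : IsZero (P.opcycles i) := (IsZero.iff_id_eq_zero _).2 <| by
      rw [← cancel_epi (P.pOpcycles i)]
      exact (ha i hi).eq_of_src _ _
    exact Projective.of_iso this.isoZero.symm inferInstance
  have hproj (k : ℕ) (hk : a - 1 + k < t) : Projective (P.opcycles (a - 1 + k)) := by
    induction k with
    | zero => exact hlow _ (by simp)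
    | succ k ih =>
      exact P.projective_opcycles_of_isZero_homology _ (a - 1 + k) (by simp; ring) (hP _)
        (ih (by lia)) (ht _ hk)
  have hpred : Projective (P.opcycles (t - 1)) := by
    by_cases h : t - 1 < a
    · exact hlow _ h
    · have := hproj (t - a).toNat (by lia)
      rwa [show a - 1 + ((t - a).toNat : ℤ) = t - 1 by lia] at this
  obtain ⟨r, hr, -⟩ := P.exists_retraction_homologyι t (t - 1) (by simp) (hP _) hpred
  exact ⟨r, hr⟩

/-- The embedding of `ℕ` in `ℤ`, as an embedding of complex shapes of chain complexes. -/
def embeddingNat : (ComplexShape.down ℕ).Embedding (ComplexShape.down ℤ) :=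
  ComplexShape.Embedding.mk' _ _ (fun n => (n : ℤ)) (fun _ _ h => by simpa using h)
    (fun i j => by simp; lia)

@[simp]
lemma embeddingNat_f (k : ℕ) : embeddingNat.f k = k := rfl

/-- The embedding of the integers `≤ n`, as an embedding of complex shapes. -/
def embeddingLE (n : ℤ) : (ComplexShape.up ℕ).Embedding (ComplexShape.down ℤ) :=
  ComplexShape.Embedding.mk' _ _ (fun i => n - i) (fun _ _ h => by simpa using h)
    (fun i j => by simp; lia)

@[simp]
lemma embeddingLE_f (n : ℤ) (i : ℕ) : (embeddingLE n).f i = n - i := rfl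

instance (n : ℤ) : (embeddingLE n).IsTruncGE where
  rel' i j h := by simp at h ⊢; lia
  mem_next {j k} h := ⟨j + 1, by simp at h ⊢; lia⟩

lemma pdLE_of_projective_opcycles {M : A} (Q : ProjectiveResolution M) (n : ℕ)
    (h : Projective (Q.complex.opcycles n)) : pdLE M n := by
  let K := Q.complex.extend embeddingNat
  let L := K.truncGE (embeddingLE n)
  have hK (k : ℕ) : Projective (K.X k) :=
    Projective.of_iso (Q.complex.extendXIso embeddingNat (i := k) rfl).symm inferInstance
  have hK' (i : ℤ) (hi : i < 0) : IsZero (K.X i) :=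
    Q.complex.isZero_extend_X _ _ (fun k => by simp; lia)
  have hL (i : ℤ) (hi : n < i) : IsZero (L.X i) :=
    (K.truncGE (embeddingLE n)).isZero_X_of_isStrictlySupported (embeddingLE n) i
      (fun k => by simp; lia)
  have hboundary (k : ℕ) : (embeddingLE n).BoundaryGE k ↔ k = 0 := by
    constructor
    · intro hk
      by_contra! h0
      exact hk.2 (k - 1) (by simp; lia)
    · rintro rfl
      exact ⟨by simp, fun k => by simp; lia⟩
  have hLX (i : ℤ) (hi : i < n) : Nonempty (L.X i ≅ K.X i) :=
    ⟨K.truncGEXIso (embeddingLE n) (i := (n - i).toNat) (by simp; lia)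
      (by rw [hboundary]; lia)⟩
  have hLn : L.X n ≅ Q.complex.opcycles n :=
    K.truncGEXIsoOpcycles (embeddingLE n) (i := 0) (by simp)
      ((hboundary 0).2 rfl) ≪≫ Q.complex.extendOpcyclesIso embeddingNat rfl
  have hneg (i : ℤ) (hi : i < 0) : IsZero (L.X i) :=
    (hK' i hi).of_iso (hLX i (by lia)).some
  have hhom (k : ℕ) (hk : k ≤ n) : Nonempty (L.homology k ≅ Q.complex.homology k) := by
    have := K.quasiIsoAt_πTruncGE (embeddingLE n) (j := n - k) (j' := k)
      (by simp; lia)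
    exact ⟨(isoOfQuasiIsoAt (K.πTruncGE (embeddingLE n)) (k : ℤ)).symm ≪≫
      Q.complex.extendHomologyIso embeddingNat rfl⟩
  refine ⟨L, fun i => ?_, hneg, hL, fun i hi => ?_, ?_⟩
  · rcases lt_trichotomy i n with hin | rfl | hin
    · rcases lt_or_ge i 0 with h0 | h0
      · exact Projective.of_iso (hneg i h0).isoZero.symm inferInstance
      · lift i to ℕ using h0
        exact Projective.of_iso (hLX i hin).some.symm (hK i)
    · exact Projective.of_iso hLn.symm h
    · exact Projective.of_iso (hL i hin).isoZero.symm inferInstance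
  · by_cases h : 0 ≤ i ∧ i ≤ n
    · obtain ⟨k, rfl⟩ : ∃ k : ℕ, i = (k + 1 : ℕ) := ⟨(i - 1).toNat, by lia⟩
      exact (Q.complex_exactAt_succ k).isZero_homology.of_iso (hhom (k + 1) (by lia)).some
    · refine (HomologicalComplex.exactAt_iff_isZero_homology _ _).1
        (ShortComplex.exact_of_isZero_X₂ _ ?_)
      by_cases h0 : i < 0
      · exact hneg i h0
      · exact hL i (by lia)
  · exact ⟨(hhom 0 (by lia)).some ≪≫ Q.complex.isoHomologyι₀ ≪≫ Q.opcyclesZeroIso⟩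

lemma pd_lt_top_of_pdLE {M : A} {n : ℕ} (h : pdLE M n) : pd M < ⊤ :=
  lt_of_le_of_lt (sInf_le ⟨n, rfl, h⟩) (ENat.natCast_lt_top n)

lemma exists_isFiniteQuasiProjRes_of_qpd_lt_top {M : A} (hM : ¬ IsZero M) (h : qpd M < ⊤) :
    ∃ P : ChainComplex A ℤ, IsFiniteQuasiProjRes M P := by
  rw [qpd, if_neg hM, sInf_lt_iff] at h
  obtain ⟨_, ⟨P, _, _, hP, _⟩, _⟩ := h
  exact ⟨P, hP⟩

end QPD

end

open QPD in
/-- If `qpd M < ∞` and `Ext^n(M, M) = 0` for all `n ≥ 2`,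
then `pd M < ∞`. -/
theorem pd_lt_top_of_qpd_lt_top {A : Type*} [Category A] [Abelian A] [EnoughProjectives A]
    (M : A) (h1 : qpd M < ⊤) (h2 : ∀ n : ℕ, 2 ≤ n → extIsZero M M n) :
    pd M < ⊤ := by
  have Q := projectiveResolution M
  by_cases hM : IsZero M
  · exact pd_lt_top_of_pdLE (n := 0) (pdLE_of_projective_opcycles Q 0
      (Projective.of_iso (hM.of_iso Q.opcyclesZeroIso).isoZero.symm inferInstance))
  obtain ⟨P, hP⟩ := exists_isFiniteQuasiProjRes_of_qpd_lt_top hM h1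
  obtain ⟨a, ha⟩ := hP.bddBelow
  obtain ⟨b, hb⟩ := hP.bddAbove
  obtain ⟨mult, hmult, e⟩ := hP.homology_iso
  have hlow (j : ℤ) (hj : mult j ≠ 0) : a ≤ j := by
    by_contra! h
    refine not_isZero_copies hM hj (IsZero.of_iso ?_ (e j).some.symm)
    exact (HomologicalComplex.exactAt_iff_isZero_homology _ _).1
      (ShortComplex.exact_of_isZero_X₂ _ (ha j h))
  obtain ⟨t, ht, htmin⟩ := Int.exists_least_of_bdd ⟨a, hlow⟩ hmult
  obtain ⟨r, hr⟩ := exists_retraction_homologyι_of_isZero P hP.projective ha (t := t)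
    fun i hi => by
      obtain ⟨e⟩ := e i
      rw [show mult i = 0 by by_contra h; exact absurd (htmin i h) (by lia)] at e
      exact (isZero_copies_zero M).of_iso e
  obtain ⟨s, p, hsp⟩ := exists_retract_copies M ht
  have h0 : IsStableRetract M (P.opcycles t) :=
    ⟨P.X t, hP.projective t, s ≫ (e t).some.inv ≫ P.homologyι t, r ≫ (e t).some.hom ≫ p, 0, 0, by
      simp [reassoc_of% hr, hsp]⟩
  have hn := isStableRetract_opcycles Q h2 P hP.projective mult e h0 (b + 1 - t).toNat
  refine pd_lt_top_of_pdLE (pdLE_of_projective_opcycles Q _ (hn.projective_of_isZero ?_))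
  rw [IsZero.iff_id_eq_zero, ← cancel_epi (P.pOpcycles _)]
  exact (hb _ (by lia)).eq_of_src _ _
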